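/- Let A be a complex unital Banach algebra, let a ∈ A, let p, q ∈ A be idempotents, and suppose b ∈ A satisfies b·a·b = b, R_r(b) = R_r(p) and K_r(b) = R_r(q) (i.e., b = a^{(2,l)}_{p,q}). Set κ = ‖a‖·‖b‖. Let p′, q′ ∈ A be idempotents with ‖p − p′‖ < 1/(1 + κ)² and ‖q − q′‖ < 1/(3 + κ). Then there exists b″ ∈ A with b″·a·b″ = b″, R_r(b″) = R_r(p′) and K_r(b″) = R_r(q′) (i.e., a^{(2,l)}_{p′,q′} exists), and it satisfies ‖b″ − b‖ ≤ (1 + κ)·(‖p − p′‖ + ‖q − q′‖)·‖b‖ / (1 − (1 + κ)·‖p − p′‖ − κ·‖q − q′‖) and ‖b″‖ ≤ (1 + ‖q − q′‖)·‖b‖ / (1 − (1 + κ)·‖p − p′‖ − κ·‖q − q′‖). -/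

import Mathlib

/-- Right range `R_r(a) = {a·x : x ∈ A}`. -/
def Rr {A : Type*} [Ring A] (a : A) : Set A := {y | ∃ x, y = a * x}

/-- Right kernel `K_r(a) = {x ∈ A : a·x = 0}`. -/
def Kr {A : Type*} [Ring A] (a : A) : Set A := {x | a * x = 0}

/-- Left range `R_l(a) = {x·a : x ∈ A}`. -/
def Rl {A : Type*} [Ring A] (a : A) : Set A := {y | ∃ x, y = x * a}

/-- Left kernel `K_l(a) = {x ∈ A : x·a = 0}`. -/
def Kl {A : Type*} [Ring A] (a : A) : Set A := {x | x * a = 0}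

/-- In a complete normed ring, `1 - x` has a two-sided inverse when `‖x‖ < 1`. -/
theorem exists_inverse_one_sub {A : Type*} [NormedRing A] [CompleteSpace A] {x : A}
    (hx : ‖x‖ < 1) : ∃ s : A, s * (1 - x) = 1 ∧ (1 - x) * s = 1 :=
  ⟨↑(Units.oneSub x hx)⁻¹, (Units.oneSub x hx).inv_mul, (Units.oneSub x hx).mul_inv⟩

/-- If `b` is an outer inverse of `a` with range `R_r(p)`, then `b * a` fixes `p`. -/
theorem mul_mul_eq_of_Rr_eq {A : Type*} [Ring A] {a b p : A} (hp : p * p = p)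
    (hb1 : b * a * b = b) (hb2 : Rr b = Rr p) : b * a * p = p := by
  obtain ⟨y, hy⟩ : p ∈ Rr b := hb2 ▸ ⟨p, hp.symm⟩
  rw [hy, ← mul_assoc, hb1]

/-- If `R_r(b) = R_r(p)` with `p` idempotent, then `p * b = b`. -/
theorem mul_eq_of_Rr_eq {A : Type*} [Ring A] {b p : A} (hp : p * p = p)
    (hb2 : Rr b = Rr p) : p * b = b := by
  obtain ⟨y, hy⟩ : b ∈ Rr p := hb2 ▸ ⟨1, (mul_one b).symm⟩
  rw [hy, ← mul_assoc, hp]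

/-- If `K_r(b) = R_r(q)` and `q'` is an idempotent with `‖q - q'‖ < 1`, then
`K_r(b * (1 - q')) = R_r(q')`. -/
theorem Kr_mul_one_sub_eq {A : Type*} [NormedRing A] {b q q' : A} (hq : q * q = q)
    (hq' : q' * q' = q') (hb3 : Kr b = Rr q) (hqq' : ‖q - q'‖ < 1) :
    Kr (b * (1 - q')) = Rr q' := by
  ext x
  constructor
  · intro hx
    have hx' : (1 - q') * x ∈ Kr b := by
      change b * ((1 - q') * x) = 0
      rw [← mul_assoc]
      exact hx
    obtain ⟨z, hz⟩ := hb3 ▸ hx'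
    have hqy : q * ((1 - q') * x) = (1 - q') * x := by rw [hz, ← mul_assoc, hq]
    have hq'y : q' * ((1 - q') * x) = 0 := by
      rw [← mul_assoc, mul_sub, hq', mul_one, sub_self, zero_mul]
    have hy : (q - q') * ((1 - q') * x) = (1 - q') * x := by
      rw [sub_mul, hqy, hq'y, sub_zero]
    have hnorm : ‖(1 - q') * x‖ ≤ ‖q - q'‖ * ‖(1 - q') * x‖ := by
      conv_lhs => rw [← hy]
      exact norm_mul_le _ _
    have hzero : (1 - q') * x = 0 := by
      rw [← norm_eq_zero]
      nlinarith [norm_nonneg ((1 - q') * x)]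
    refine ⟨x, ?_⟩
    rwa [sub_mul, one_mul, sub_eq_zero] at hzero
  · rintro ⟨y, rfl⟩
    change b * (1 - q') * (q' * y) = 0
    rw [mul_assoc, ← mul_assoc (1 - q'), sub_mul, one_mul, hq', sub_self, zero_mul, mul_zero]

/-- The smallness conditions on the perturbations, combined. -/
theorem perturbation_bound {k d e : ℝ} (hk : 0 ≤ k) (hd : d < 1 / (1 + k) ^ 2)
    (he : e < 1 / (3 + k)) : (1 + k) * d + k * e < 1 := by
  have h1 : (1 + k) * d < 1 / (1 + k) := by
    calc (1 + k) * d < (1 + k) * (1 / (1 + k) ^ 2) := by gcongr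
      _ = 1 / (1 + k) := by field_simp
  have h2 : k * e ≤ k * (1 / (3 + k)) := by gcongr
  have h3 : 1 / (1 + k) + k * (1 / (3 + k)) ≤ 1 := by
    have h4 : 1 / (1 + k) + k * (1 / (3 + k)) = (3 + 2 * k + k ^ 2) / ((1 + k) * (3 + k)) := by
      field_simp
      ring
    rw [h4, div_le_one (by positivity)]
    nlinarith
  linarith

theorem stmt17 {A : Type*} [NormedRing A] [NormedAlgebra ℂ A] [CompleteSpace A]
    (a p q b p' q' : A) (hp : p * p = p) (hq : q * q = q)
    (hp' : p' * p' = p') (hq' : q' * q' = q')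
    (hb1 : b * a * b = b) (hb2 : Rr b = Rr p) (hb3 : Kr b = Rr q)
    (hpp' : ‖p - p'‖ < 1 / (1 + ‖a‖ * ‖b‖) ^ 2)
    (hqq' : ‖q - q'‖ < 1 / (3 + ‖a‖ * ‖b‖)) :
    ∃ b'' : A, b'' * a * b'' = b'' ∧ Rr b'' = Rr p' ∧ Kr b'' = Rr q' ∧
      ‖b'' - b‖ ≤ (1 + ‖a‖ * ‖b‖) * (‖p - p'‖ + ‖q - q'‖) * ‖b‖ /
          (1 - (1 + ‖a‖ * ‖b‖) * ‖p - p'‖ - ‖a‖ * ‖b‖ * ‖q - q'‖) ∧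
      ‖b''‖ ≤ (1 + ‖q - q'‖) * ‖b‖ /
          (1 - (1 + ‖a‖ * ‖b‖) * ‖p - p'‖ - ‖a‖ * ‖b‖ * ‖q - q'‖) := by
  have hbap := mul_mul_eq_of_Rr_eq hp hb1 hb2
  have hpb := mul_eq_of_Rr_eq hp hb2
  have hbq : b * q = 0 := by
    have h : q ∈ Kr b := hb3 ▸ ⟨q, hq.symm⟩
    exact h
  have hk : 0 ≤ ‖a‖ * ‖b‖ := by positivity
  have hη := perturbation_bound hk hpp' hqq'
  have he1 : ‖q - q'‖ < 1 := hqq'.trans_le (by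
    rw [div_le_one (by positivity)]
    linarith)
  have hd0 := norm_nonneg (p - p')
  have he0 := norm_nonneg (q - q')
  have hbδ : ‖b * a * (p - p')‖ ≤ ‖a‖ * ‖b‖ * ‖p - p'‖ :=
    norm_mul₃_le.trans_eq (by ring)
  have hbε : ‖b * (q - q') * a‖ ≤ ‖a‖ * ‖b‖ * ‖q - q'‖ :=
    norm_mul₃_le.trans_eq (by ring)
  -- `E` is the error term in the equation `(1 - E) * b'' = b * (1 - q')` determining `b''`.
  obtain ⟨E, hE⟩ : ∃ E, E = b * a * (p - p') - (p - p') - b * (q - q') * a := ⟨_, rfl⟩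
  have hEn : ‖E‖ ≤ (1 + ‖a‖ * ‖b‖) * ‖p - p'‖ + ‖a‖ * ‖b‖ * ‖q - q'‖ := by
    have h1 := norm_sub_le (b * a * (p - p') - (p - p')) (b * (q - q') * a)
    have h2 := norm_sub_le (b * a * (p - p')) (p - p')
    rw [hE]
    linarith
  obtain ⟨s, hs1, hs2⟩ := exists_inverse_one_sub (hEn.trans_lt hη)
  have hEp' : (1 - E) * p' = b * (1 - q') * a * p' := by
    have h : (1 - E) * p' - b * (1 - q') * a * p'
        = (p - b * a * p) * p' + (p' - p' * p') - b * a * (p' - p' * p') + b * q * a * p' := by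
      rw [hE]
      noncomm_ring
    rw [← sub_eq_zero, h, hbap, hp', hbq]
    simp
  -- `1 - F` is invertible and agrees with `(1 - E) * p'` on `R_r(p)`.
  obtain ⟨F, hF⟩ : ∃ F, F = b * a * (p - p') - b * (q - q') * a + b * (q - q') * a * (p - p') :=
    ⟨_, rfl⟩
  have hFn : ‖F‖ < 1 := by
    have h1 := norm_add_le (b * a * (p - p') - b * (q - q') * a) (b * (q - q') * a * (p - p'))
    have h2 := norm_sub_le (b * a * (p - p')) (b * (q - q') * a)
    have h3 : ‖b * (q - q') * a * (p - p')‖ ≤ ‖p - p'‖ := by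
      have h4 : ‖a‖ * ‖b‖ * ‖q - q'‖ ≤ 1 := by nlinarith
      calc _ ≤ ‖b * (q - q') * a‖ * ‖p - p'‖ := norm_mul_le _ _
        _ ≤ 1 * ‖p - p'‖ := by gcongr; exact hbε.trans h4
        _ = _ := one_mul _
    rw [hF]
    linarith
  obtain ⟨g, hg1, hg2⟩ := exists_inverse_one_sub hFn
  have hFp : (1 - F) * p = b * (1 - q') * a * p' * p := by
    have h : (1 - F) * p - b * (1 - q') * a * p' * p
        = (p - b * a * p * p) + b * q * a * p' * p
          + b * (q - q') * a * (p - p * p) := by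
      rw [hF]
      noncomm_ring
    rw [← sub_eq_zero, h, hbap, hp, hbq]
    simp
  have hpF : (1 - p) * (1 - F) = 1 - p := by
    have h : p * F = F := by
      rw [hF]
      simp only [mul_add, mul_sub p (b * a * (p - p')), ← mul_assoc, hpb]
    rw [mul_sub, mul_one, sub_mul 1 p F, h, one_mul, sub_self, sub_zero]
  have hpg : p * (g * p) = g * p := by
    have h : (1 - p) * g = 1 - p := by
      conv_lhs => rw [← hpF, mul_assoc, hg2, mul_one]
    have h' : (1 - p) * (g * p) = 0 := by
      rw [← mul_assoc, h, sub_mul, hp, one_mul, sub_self]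
    rw [sub_mul, one_mul, sub_eq_zero] at h'
    exact h'.symm
  have hp_eq : p = (1 - E) * (p' * (g * p)) := by
    calc p = (1 - F) * (g * p) := by rw [← mul_assoc, hg2, one_mul]
      _ = (1 - F) * p * (g * p) := by rw [mul_assoc, hpg]
      _ = (1 - E) * p' * (p * (g * p)) := by rw [hFp, hEp', mul_assoc _ p (g * p)]
      _ = _ := by rw [hpg, mul_assoc]
  obtain ⟨c, hc⟩ : ∃ c, c = s * (b * (1 - q')) := ⟨_, rfl⟩
  have hEc : (1 - E) * c = b * (1 - q') := by rw [hc, ← mul_assoc, hs2, one_mul]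
  have hcap : c * a * p' = p' := by
    calc c * a * p' = s * (b * (1 - q') * a * p') := by simp only [hc, mul_assoc]
      _ = p' := by rw [← hEp', ← mul_assoc, hs1, one_mul]
  have hcp : c = p' * (g * p * (b * (1 - q'))) := by
    calc c = s * (p * (b * (1 - q'))) := by rw [← mul_assoc p, hpb, hc]
      _ = s * ((1 - E) * (p' * (g * p)) * (b * (1 - q'))) := by rw [← hp_eq]
      _ = s * (1 - E) * (p' * (g * p * (b * (1 - q')))) := by simp only [mul_assoc]
      _ = _ := by rw [hs1, one_mul]
  have hp'c : p' * c = c := by rw [hcp, ← mul_assoc, hp']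
  have hcfix : c = b + b * (q - q') + E * c := by
    have h : c = (1 - E) * c + E * c := by noncomm_ring
    rw [hEc, mul_sub, mul_one] at h
    rw [mul_sub, hbq, zero_sub, ← sub_eq_add_neg]
    exact h
  have hbεn : ‖b * (q - q')‖ ≤ ‖q - q'‖ * ‖b‖ := (norm_mul_le _ _).trans_eq (mul_comm _ _)
  have hpos : 0 < 1 - (1 + ‖a‖ * ‖b‖) * ‖p - p'‖ - ‖a‖ * ‖b‖ * ‖q - q'‖ := by linarith
  have hE_mul : ∀ x, ‖E * x‖
      ≤ ((1 + ‖a‖ * ‖b‖) * ‖p - p'‖ + ‖a‖ * ‖b‖ * ‖q - q'‖) * ‖x‖ := fun x =>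
    (norm_mul_le _ _).trans (by gcongr)
  refine ⟨c, ?_, ?_, ?_, ?_, ?_⟩
  · calc c * a * c = c * a * p' * c := by rw [mul_assoc _ p' c, hp'c]
      _ = c := by rw [hcap, hp'c]
  · ext x
    constructor
    · rintro ⟨y, rfl⟩
      exact ⟨c * y, by rw [← mul_assoc, hp'c]⟩
    · rintro ⟨y, rfl⟩
      exact ⟨a * p' * y, by simp only [← mul_assoc, hcap]⟩
  · rw [← Kr_mul_one_sub_eq hq hq' hb3 he1]
    ext x
    change c * x = 0 ↔ b * (1 - q') * x = 0
    constructor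
    · intro h
      rw [← hEc, mul_assoc, h, mul_zero]
    · intro h
      rw [hc, mul_assoc, h, mul_zero]
  · rw [le_div_iff₀ hpos]
    have h : c - b = b * (q - q') + E * b + E * (c - b) := by
      calc c - b = b + b * (q - q') + E * c - b := by rw [← hcfix]
        _ = _ := by noncomm_ring
    have h1 : ‖c - b‖ ≤ ‖b * (q - q')‖ + ‖E * b‖ + ‖E * (c - b)‖ := by
      conv_lhs => rw [h]
      exact norm_add₃_le
    linarith [hE_mul b, hE_mul (c - b)]
  · rw [le_div_iff₀ hpos]
    have h1 : ‖c‖ ≤ ‖b‖ + ‖b * (q - q')‖ + ‖E * c‖ := by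
      conv_lhs => rw [hcfix]
      exact norm_add₃_le
    linarith [hE_mul c]
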